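/- Assume J is three times continuously differentiable. Then for all ψ_h, φ_h ∈ V_h there holds the error representation J(u) − J(u_h) = (1/2) ρ(u_h)(z − φ_h) + (1/2) ρ*(z_h)(u − ψ_h) + R_S + R_J, where R_S := (1/2) S(u_h)(φ_h + z_h) + (1/2) S*(z_h)(ψ_h − u_h) and, with e := u − u_h, R_J := (1/2) ∫₀¹ J'''(u_h + s·e)(e, e, e) · s · (s − 1) ds. -/

import Mathlib

open intervalIntegral

/-- Along a line, the `n`-th derivative in the direction of the line differentiates to the
`(n + 1)`-st. -/
theorem ContDiff.hasDerivAt_iteratedFDeriv_line {V W : Type*} [NormedAddCommGroup V]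
    [NormedSpace ℝ V] [NormedAddCommGroup W] [NormedSpace ℝ W] {f : V → W} {N : WithTop ℕ∞}
    (hf : ContDiff ℝ N f) {n : ℕ} (hn : n < N) (x e : V) (s : ℝ) :
    HasDerivAt (fun t : ℝ => iteratedFDeriv ℝ n f (x + t • e) fun _ => e)
      (iteratedFDeriv ℝ (n + 1) f (x + s • e) fun _ => e) s := by
  have hline : HasDerivAt (fun t : ℝ => x + t • e) e s := by
    simpa using ((hasDerivAt_id s).smul_const e).const_add x
  have hcomp := ((hf.differentiable_iteratedFDeriv hn) (x + s • e)).hasFDerivAt.comp_hasDerivAt s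
    hline
  exact ((ContinuousMultilinearMap.apply ℝ (fun _ : Fin n => V) W
    (fun _ => e)).hasFDerivAt.comp_hasDerivAt s hcomp)

/-- The trapezoidal rule with integral remainder along a segment. -/
theorem ContDiff.sub_eq_trapezoid_add_integral {V : Type*} [NormedAddCommGroup V]
    [NormedSpace ℝ V] {J : V → ℝ} (hJ : ContDiff ℝ 3 J) (x e : V) :
    J (x + e) - J x = (1 / 2) * (fderiv ℝ J x e + fderiv ℝ J (x + e) e) +
      (1 / 2) * ∫ s in (0:ℝ)..1,
        (iteratedFDeriv ℝ 3 J (x + s • e) fun _ => e) * s * (s - 1) := by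
  have h0 := hJ.hasDerivAt_iteratedFDeriv_line (n := 0) (by norm_num) x e
  have h1 := hJ.hasDerivAt_iteratedFDeriv_line (n := 1) (by norm_num) x e
  have h2 := hJ.hasDerivAt_iteratedFDeriv_line (n := 2) (by norm_cast) x e
  have hcont : Continuous fun s : ℝ =>
      (iteratedFDeriv ℝ 3 J (x + s • e) fun _ => e) * s * (s - 1) := by
    have h3 : Continuous (iteratedFDeriv ℝ 3 J) := hJ.continuous_iteratedFDeriv (by norm_num)
    have h3line : Continuous fun s : ℝ => iteratedFDeriv ℝ 3 J (x + s • e) fun _ => e :=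
      (ContinuousMultilinearMap.apply ℝ (fun _ : Fin 3 => V) ℝ (fun _ => e)).continuous.comp
        (h3.comp (by fun_prop))
    fun_prop
  have hprim (s : ℝ) : HasDerivAt
      (fun t : ℝ => t * (t - 1) * (iteratedFDeriv ℝ 2 J (x + t • e) fun _ => e)
        - (2 * t - 1) * (iteratedFDeriv ℝ 1 J (x + t • e) fun _ => e)
        + 2 * (iteratedFDeriv ℝ 0 J (x + t • e) fun _ => e))
      ((iteratedFDeriv ℝ 3 J (x + s • e) fun _ => e) * s * (s - 1)) s := by
    have hid := hasDerivAt_id' s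
    refine ((((hid.mul (hid.sub_const 1)).mul (h2 s)).sub
      (((hid.const_mul 2).sub_const 1).mul (h1 s))).add ((h0 s).const_mul 2)).congr_deriv ?_
    simp only [Pi.mul_apply, Nat.reduceAdd]
    ring
  rw [integral_eq_sub_of_hasDerivAt (fun s _ => hprim s) (hcont.intervalIntegrable 0 1)]
  simp only [iteratedFDeriv_zero_apply, iteratedFDeriv_one_apply, one_smul, zero_smul, add_zero]
  ring

/-- **DWR error representation with stabilization remainders** (Theorem 3.2).
`V` is a real normed space, `A` a continuous bilinear form with adjoint
`A*(z)(ψ) = A(ψ)(z)`, `F` a continuous linear functional, `J : V → ℝ` three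
times continuously differentiable, `Vh ⊆ V` the finite element subspace and
`S, S*` stabilization forms, linear in their second entry.  The exact
solutions `u, z` satisfy the primal and dual equations, the discrete
stabilized solutions `u_h, z_h ∈ Vh` satisfy the SUPG-stabilized primal and
dual equations.  With the residuals `ρ(u_h)(φ) = F(φ) − A(u_h)(φ)` and
`ρ*(z_h)(ψ) = J'(u_h)(ψ) − A*(z_h)(ψ)`, for all `ψ_h, φ_h ∈ Vh` there holds
`J(u) − J(u_h) = ½ ρ(u_h)(z − φ_h) + ½ ρ*(z_h)(u − ψ_h) + R_S + R_J` with
`R_S = ½ S(u_h)(φ_h + z_h) + ½ S*(z_h)(ψ_h − u_h)` and, `e := u − u_h`,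
`R_J = ½ ∫₀¹ J'''(u_h + s e)(e,e,e) · s · (s−1) ds`. -/
theorem dwr_error_representation
    {V : Type*} [NormedAddCommGroup V] [NormedSpace ℝ V]
    (A : V →L[ℝ] V →L[ℝ] ℝ) (F : V →L[ℝ] ℝ)
    (J : V → ℝ) (hJ : ContDiff ℝ 3 J)
    (Vh : Submodule ℝ V) (S Sstar : V → V →ₗ[ℝ] ℝ)
    (u z uh zh : V) (huh : uh ∈ Vh) (hzh : zh ∈ Vh)
    (hprimal : ∀ φ : V, A u φ = F φ)
    (hdual : ∀ ψ : V, A ψ z = fderiv ℝ J u ψ)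
    (hprimal_h : ∀ φh ∈ Vh, A uh φh + S uh φh = F φh)
    (hdual_h : ∀ ψh ∈ Vh, A ψh zh + Sstar zh ψh = fderiv ℝ J uh ψh) :
    ∀ ψh ∈ Vh, ∀ φh ∈ Vh,
      J u - J uh =
        (1 / 2) * (F (z - φh) - A uh (z - φh)) +
          (1 / 2) * (fderiv ℝ J uh (u - ψh) - A (u - ψh) zh) +
          ((1 / 2) * S uh (φh + zh) + (1 / 2) * Sstar zh (ψh - uh)) +
          (1 / 2) * ∫ s in (0:ℝ)..1,
            (iteratedFDeriv ℝ 3 J (uh + s • (u - uh)) fun _ => u - uh)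
              * s * (s - 1) := by
  intro ψh hψh φh hφh
  have htrap := hJ.sub_eq_trapezoid_add_integral uh (u - uh)
  rw [add_sub_cancel] at htrap
  rw [htrap]
  have hdual_u := hdual u
  have hdual_uh := hdual uh
  have hprimal_z := hprimal z
  have hprimal_zh := hprimal zh
  have hprimal_h_φh := hprimal_h φh hφh
  have hprimal_h_zh := hprimal_h zh hzh
  have hdual_h_ψh := hdual_h ψh hψh
  have hdual_h_uh := hdual_h uh huh
  simp only [map_sub, map_add, sub_apply]
  linarith
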